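/- Let ρ_AB be a density operator on H_A ⊗ H_B. Let α > 0 and β, γ ≥ 1/2 with α, β, γ ≠ 1 satisfy α/(α−1) = β/(β−1) + γ/(γ−1) and (α−1)(β−1)(γ−1) > 0. Then I↓_γ(A:B)_ρ ≥ H_β(B)_ρ − H↑_α(B|A)_ρ. -/

import Mathlib

open scoped Kronecker ComplexOrder Classical
open Matrix

noncomputable section

/-- Real power taken on the support: `0 ^ r = 0` for every `r`. -/
def supPow (x r : ℝ) : ℝ := if x = 0 then 0 else x ^ r

variable {n : Type*} [Fintype n] [DecidableEq n]

/-- Power of a Hermitian matrix, taken on its support (junk value `0` otherwise). -/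
def matPow (M : Matrix n n ℂ) (r : ℝ) : Matrix n n ℂ :=
  if hM : M.IsHermitian then
    (hM.eigenvectorUnitary : Matrix n n ℂ) *
      (Matrix.diagonal fun i => (supPow (hM.eigenvalues i) r : ℂ)) *
      (star (hM.eigenvectorUnitary : Matrix n n ℂ))
  else 0

/-- A density operator: positive semidefinite with unit trace. -/
def IsDensity (ρ : Matrix n n ℂ) : Prop := ρ.PosSemidef ∧ ρ.trace = 1

/-- `σ` dominates `ρ`: the kernel of `σ` is contained in the kernel of `ρ`
(equivalently, `supp ρ ⊆ supp σ` for positive semidefinite matrices). -/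
def Dominates (σ ρ : Matrix n n ℂ) : Prop := ∀ v, σ.mulVec v = 0 → ρ.mulVec v = 0

/-- The sandwiched Rényi divergence of order `α` (base-2 logarithm), with value `⊤`
when `ρ ⟂ σ`, or when `α > 1` and `supp ρ ⊄ supp σ`. -/
def renyiDiv (α : ℝ) (ρ σ : Matrix n n ℂ) : EReal :=
  if (ρ * σ).trace ≠ 0 ∧ (Dominates σ ρ ∨ α < 1) then
    (((α - 1)⁻¹ * Real.logb 2
      ((matPow (matPow σ ((1 - α) / (2 * α)) * ρ * matPow σ ((1 - α) / (2 * α))) α).trace.re) : ℝ)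
      : EReal)
  else ⊤

/-- The Rényi entropy of order `α` (base-2 logarithm). -/
def renyiEntropy (α : ℝ) (ρ : Matrix n n ℂ) : ℝ :=
  (1 - α)⁻¹ * Real.logb 2 ((matPow ρ α).trace.re)

variable {A B : Type*} [Fintype A] [Fintype B] [DecidableEq A] [DecidableEq B]

/-- Marginal on the first factor: `ρ_A = tr_B ρ_AB`. -/
def margFst (ρ : Matrix (A × B) (A × B) ℂ) : Matrix A A ℂ :=
  Matrix.of fun a a' => ∑ b, ρ (a, b) (a', b)

/-- Marginal on the second factor: `ρ_B = tr_A ρ_AB`. -/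
def margSnd (ρ : Matrix (A × B) (A × B) ℂ) : Matrix B B ℂ :=
  Matrix.of fun b b' => ∑ a, ρ (a, b) (a, b')

/-- `H↓_α(B|A)_ρ = −D_α(ρ_AB ‖ ρ_A ⊗ 1_B)`. -/
def condEntDown (α : ℝ) (ρ : Matrix (A × B) (A × B) ℂ) : EReal :=
  - renyiDiv α ρ (margFst ρ ⊗ₖ (1 : Matrix B B ℂ))

/-- `H↑_α(B|A)_ρ = sup_{σ_A} −D_α(ρ_AB ‖ σ_A ⊗ 1_B)`. -/
def condEntUp (α : ℝ) (ρ : Matrix (A × B) (A × B) ℂ) : EReal :=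
  ⨆ σA : {σ : Matrix A A ℂ // IsDensity σ},
    - renyiDiv α ρ ((σA : Matrix A A ℂ) ⊗ₖ (1 : Matrix B B ℂ))

/-- `I↑_γ(A;B)_ρ = inf_{σ_B} D_γ(ρ_AB ‖ ρ_A ⊗ σ_B)`. -/
def mutInfUp (γ : ℝ) (ρ : Matrix (A × B) (A × B) ℂ) : EReal :=
  ⨅ σB : {σ : Matrix B B ℂ // IsDensity σ},
    renyiDiv γ ρ (margFst ρ ⊗ₖ (σB : Matrix B B ℂ))

/-- `I↓_γ(A:B)_ρ = inf_{σ_A, σ_B} D_γ(ρ_AB ‖ σ_A ⊗ σ_B)`. -/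
def mutInfDown (γ : ℝ) (ρ : Matrix (A × B) (A × B) ℂ) : EReal :=
  ⨅ σA : {σ : Matrix A A ℂ // IsDensity σ}, ⨅ σB : {σ : Matrix B B ℂ // IsDensity σ},
    renyiDiv γ ρ ((σA : Matrix A A ℂ) ⊗ₖ (σB : Matrix B B ℂ))

end

theorem sum_mul_rpow_mul_rpow_le {ι : Type*} [Fintype ι] {w u v : ι → ℝ}
    (hw : ∀ i, 0 ≤ w i) (hu : ∀ i, 0 ≤ u i) (hv : ∀ i, 0 ≤ v i)
    {s t : ℝ} (hs : 0 < s) (ht : 0 < t) (hst : s + t = 1) :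
    ∑ i, w i * (u i ^ s * v i ^ t) ≤ (∑ i, w i * u i) ^ s * (∑ i, w i * v i) ^ t := by
  have hpq : (1 / s).HolderConjugate (1 / t) := by
    rw [Real.holderConjugate_iff]
    refine ⟨?_, by simpa using hst⟩
    rw [lt_div_iff₀ hs]; linarith
  have h := Real.inner_le_Lp_mul_Lq_of_nonneg (s := Finset.univ) hpq
    (f := fun i => (w i * u i) ^ s) (g := fun i => (w i * v i) ^ t)
    (fun i _ => Real.rpow_nonneg (mul_nonneg (hw i) (hu i)) _)
    (fun i _ => Real.rpow_nonneg (mul_nonneg (hw i) (hv i)) _)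
  have h1 : ∀ i, ((w i * u i) ^ s) ^ (1 / s) = w i * u i := fun i => by
    rw [← Real.rpow_mul (mul_nonneg (hw i) (hu i)), mul_one_div_cancel hs.ne', Real.rpow_one]
  have h2 : ∀ i, ((w i * v i) ^ t) ^ (1 / t) = w i * v i := fun i => by
    rw [← Real.rpow_mul (mul_nonneg (hw i) (hv i)), mul_one_div_cancel ht.ne', Real.rpow_one]
  simp only [h1, h2, one_div_one_div] at h
  refine le_trans (le_of_eq (Finset.sum_congr rfl fun i _ => ?_)) h
  rw [Real.mul_rpow (hw i) (hu i), Real.mul_rpow (hw i) (hv i), mul_mul_mul_comm,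
    ← Real.rpow_add_of_nonneg (hw i) hs.le ht.le, hst, Real.rpow_one]

theorem log_sum_mul_rpow_mul_rpow_le {ι : Type*} [Fintype ι] {w u v : ι → ℝ}
    (hw : ∀ i, 0 ≤ w i) (hu : ∀ i, 0 ≤ u i) (hv : ∀ i, 0 ≤ v i)
    {s t : ℝ} (hs : 0 < s) (ht : 0 < t) (hst : s + t = 1)
    (hpos : 0 < ∑ i, w i * (u i ^ s * v i ^ t)) :
    Real.log (∑ i, w i * (u i ^ s * v i ^ t)) ≤
      s * Real.log (∑ i, w i * u i) + t * Real.log (∑ i, w i * v i) := by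
  have h := sum_mul_rpow_mul_rpow_le hw hu hv hs ht hst
  have hU : 0 ≤ ∑ i, w i * u i := Finset.sum_nonneg fun i _ => mul_nonneg (hw i) (hu i)
  have hV : 0 ≤ ∑ i, w i * v i := Finset.sum_nonneg fun i _ => mul_nonneg (hw i) (hv i)
  have hU' : 0 < ∑ i, w i * u i := hU.lt_of_ne fun h0 => by
    rw [← h0, Real.zero_rpow hs.ne', zero_mul] at h; linarith
  have hV' : 0 < ∑ i, w i * v i := hV.lt_of_ne fun h0 => by
    rw [← h0, Real.zero_rpow ht.ne', mul_zero] at h; linarith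
  rw [← Real.log_rpow hU', ← Real.log_rpow hV', ← Real.log_mul (by positivity) (by positivity)]
  exact Real.log_le_log hpos h

theorem supPow_nonneg {x : ℝ} (hx : 0 ≤ x) (r : ℝ) : 0 ≤ supPow x r := by
  unfold supPow; split_ifs <;> positivity

theorem supPow_pos {x : ℝ} (hx : 0 < x) (r : ℝ) : 0 < supPow x r := by
  unfold supPow; rw [if_neg hx.ne']; positivity

theorem supPow_zero_left (r : ℝ) : supPow 0 r = 0 := if_pos rfl

theorem supPow_zero_right {x : ℝ} (hx : x ≠ 0) : supPow x 0 = 1 := by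
  simp [supPow, hx]

theorem supPow_one_right (x : ℝ) : supPow x 1 = x := by
  unfold supPow; split_ifs with h <;> simp [h]

theorem supPow_eq_rpow {x r : ℝ} (hr : r ≠ 0) : supPow x r = x ^ r := by
  unfold supPow; split_ifs with h
  · rw [h, Real.zero_rpow hr]
  · rfl

theorem supPow_mul {x y : ℝ} (hx : 0 ≤ x) (hy : 0 ≤ y) (r : ℝ) :
    supPow (x * y) r = supPow x r * supPow y r := by
  unfold supPow
  by_cases h : x = 0 <;> by_cases h' : y = 0 <;> simp [h, h', Real.mul_rpow hx hy]

theorem supPow_add {x : ℝ} (hx : 0 ≤ x) (r r' : ℝ) :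
    supPow x r * supPow x r' = supPow x (r + r') := by
  unfold supPow; split_ifs with h
  · simp
  · rw [Real.rpow_add (hx.lt_of_ne' h)]

theorem supPow_rpow_mul_supPow_rpow {x : ℝ} (hx : 0 ≤ x) {s t : ℝ} (hs : 0 < s)
    (r r' : ℝ) : supPow x r ^ s * supPow x r' ^ t = supPow x (s * r + t * r') := by
  unfold supPow; split_ifs with h
  · rw [Real.zero_rpow hs.ne', zero_mul]
  · rw [← Real.rpow_mul hx, ← Real.rpow_mul hx, ← Real.rpow_add (hx.lt_of_ne' h)]
    ring_nf

/-- A weighted sum of products of three powers, each taken on its support. -/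
noncomputable def powSum {ι : Type*} [Fintype ι] (w x y z : ι → ℝ) (r₁ r₂ r₃ : ℝ) : ℝ :=
  ∑ i, w i * (supPow (x i) r₁ * supPow (y i) r₂ * supPow (z i) r₃)

theorem powSum_pos {ι : Type*} [Fintype ι] {w x y z : ι → ℝ}
    (hw : ∀ i, 0 ≤ w i) (hx : ∀ i, 0 ≤ x i) (hy : ∀ i, 0 ≤ y i) (hz : ∀ i, 0 ≤ z i)
    {i : ι} (hwi : 0 < w i) (hxi : 0 < x i) (hyi : 0 < y i) (hzi : 0 < z i)
    (r₁ r₂ r₃ : ℝ) : 0 < powSum w x y z r₁ r₂ r₃ := by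
  refine Finset.sum_pos' (fun j _ => mul_nonneg (hw j) (mul_nonneg (mul_nonneg
    (supPow_nonneg (hx j) _) (supPow_nonneg (hy j) _)) (supPow_nonneg (hz j) _)))
    ⟨i, Finset.mem_univ _, ?_⟩
  exact mul_pos hwi (mul_pos (mul_pos (supPow_pos hxi _) (supPow_pos hyi _)) (supPow_pos hzi _))

theorem log_powSum_le {ι : Type*} [Fintype ι] {w x y z : ι → ℝ}
    (hw : ∀ i, 0 ≤ w i) (hx : ∀ i, 0 ≤ x i) (hy : ∀ i, 0 ≤ y i) (hz : ∀ i, 0 ≤ z i)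
    {s t : ℝ} (hs : 0 < s) (ht : 0 < t) (hst : s + t = 1)
    (r₁ r₂ r₃ q₁ q₂ q₃ : ℝ)
    (hpos : 0 < powSum w x y z (s * r₁ + t * q₁) (s * r₂ + t * q₂) (s * r₃ + t * q₃)) :
    Real.log (powSum w x y z (s * r₁ + t * q₁) (s * r₂ + t * q₂) (s * r₃ + t * q₃)) ≤
      s * Real.log (powSum w x y z r₁ r₂ r₃) + t * Real.log (powSum w x y z q₁ q₂ q₃) := by
  have key : powSum w x y z (s * r₁ + t * q₁) (s * r₂ + t * q₂) (s * r₃ + t * q₃) =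
      ∑ i, w i * ((supPow (x i) r₁ * supPow (y i) r₂ * supPow (z i) r₃) ^ s *
        (supPow (x i) q₁ * supPow (y i) q₂ * supPow (z i) q₃) ^ t) := by
    refine Finset.sum_congr rfl fun i _ => ?_
    have hx' := fun r => supPow_nonneg (hx i) r
    have hy' := fun r => supPow_nonneg (hy i) r
    have hz' := fun r => supPow_nonneg (hz i) r
    rw [Real.mul_rpow (mul_nonneg (hx' _) (hy' _)) (hz' _), Real.mul_rpow (hx' _) (hy' _),
      Real.mul_rpow (mul_nonneg (hx' _) (hy' _)) (hz' _), Real.mul_rpow (hx' _) (hy' _),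
      ← supPow_rpow_mul_supPow_rpow (hx i) hs, ← supPow_rpow_mul_supPow_rpow (hy i) hs,
      ← supPow_rpow_mul_supPow_rpow (hz i) hs]
    ring
  rw [key] at hpos ⊢
  exact log_sum_mul_rpow_mul_rpow_le hw
    (fun i => mul_nonneg (mul_nonneg (supPow_nonneg (hx i) _) (supPow_nonneg (hy i) _))
      (supPow_nonneg (hz i) _))
    (fun i => mul_nonneg (mul_nonneg (supPow_nonneg (hx i) _) (supPow_nonneg (hy i) _))
      (supPow_nonneg (hz i) _)) hs ht hst hpos

/-- Multiplied-out convexity of the logarithm of `powSum` in the exponents. -/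
theorem mul_log_powSum_le {ι : Type*} [Fintype ι] {w x y z : ι → ℝ}
    (hw : ∀ i, 0 ≤ w i) (hx : ∀ i, 0 ≤ x i) (hy : ∀ i, 0 ≤ y i) (hz : ∀ i, 0 ≤ z i)
    {i : ι} (hwi : 0 < w i) (hxi : 0 < x i) (hyi : 0 < y i)
    (hzi : 0 < z i) {s t : ℝ} (hs : 0 < s) (ht : 0 < t)
    {p₁ p₂ p₃ r₁ r₂ r₃ q₁ q₂ q₃ : ℝ} (h₁ : (s + t) * p₁ = s * r₁ + t * q₁)
    (h₂ : (s + t) * p₂ = s * r₂ + t * q₂) (h₃ : (s + t) * p₃ = s * r₃ + t * q₃) :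
    (s + t) * Real.log (powSum w x y z p₁ p₂ p₃) ≤
      s * Real.log (powSum w x y z r₁ r₂ r₃) + t * Real.log (powSum w x y z q₁ q₂ q₃) := by
  have hst : 0 < s + t := add_pos hs ht
  have e : ∀ {p r q : ℝ}, (s + t) * p = s * r + t * q →
      p = s / (s + t) * r + t / (s + t) * q := fun {p r q} h => by
    field_simp; linarith
  have h := log_powSum_le hw hx hy hz (div_pos hs hst) (div_pos ht hst) (by field_simp)
    r₁ r₂ r₃ q₁ q₂ q₃ (powSum_pos hw hx hy hz hwi hxi hyi hzi _ _ _)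
  rw [← e h₁, ← e h₂, ← e h₃] at h
  calc _ ≤ (s + t) * (s / (s + t) * Real.log (powSum w x y z r₁ r₂ r₃) +
        t / (s + t) * Real.log (powSum w x y z q₁ q₂ q₃)) := by gcongr
    _ = _ := by field_simp

theorem log_powSum_decomposition {ι : Type*} [Fintype ι] {w x y z : ι → ℝ}
    (hw : ∀ i, 0 ≤ w i) (hx : ∀ i, 0 ≤ x i) (hy : ∀ i, 0 ≤ y i) (hz : ∀ i, 0 ≤ z i)
    {i : ι} (hwi : 0 < w i) (hxi : 0 < x i) (hyi : 0 < y i)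
    (hzi : 0 < z i) {a b c : ℝ} (habc : a = b + c) (hsign : 0 < a * b * c) :
    a * Real.log (powSum w x y z (-a⁻¹) 0 a⁻¹) ≤
      b * Real.log (powSum w x y z 0 b⁻¹ 0) +
        c * Real.log (powSum w x y z (-c⁻¹) (-c⁻¹) c⁻¹) := by
  have ha0 : a ≠ 0 := by rintro rfl; simp at hsign
  have hb0 : b ≠ 0 := by rintro rfl; simp at hsign
  have hc0 : c ≠ 0 := by rintro rfl; simp at hsign
  have main := fun {s t : ℝ} (hs : 0 < s) (ht : 0 < t) {p₁ p₂ p₃ r₁ r₂ r₃ q₁ q₂ q₃ : ℝ} =>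
    mul_log_powSum_le (p₁ := p₁) (p₂ := p₂) (p₃ := p₃) (r₁ := r₁) (r₂ := r₂) (r₃ := r₃)
      (q₁ := q₁) (q₂ := q₂) (q₃ := q₃) hw hx hy hz hwi hxi hyi hzi hs ht
  rcases lt_or_gt_of_ne hb0 with hb | hb <;> rcases lt_or_gt_of_ne hc0 with hc | hc
  · have : 0 < b * c := mul_pos_of_neg_of_neg hb hc
    nlinarith
  · have ha : a < 0 := by
      by_contra! h
      nlinarith [mul_nonneg (mul_nonneg h (neg_pos.2 hb).le) hc.le]
    have e : -a + c = -b := by linarith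
    have h := main (neg_pos.2 ha) hc (p₁ := 0) (p₂ := b⁻¹) (p₃ := 0) (r₁ := -a⁻¹) (r₂ := 0)
      (r₃ := a⁻¹) (q₁ := -c⁻¹) (q₂ := -c⁻¹) (q₃ := c⁻¹) (by field_simp; ring)
      (by rw [e]; field_simp; ring) (by field_simp; ring)
    rw [e] at h
    linarith
  · have ha : a < 0 := by
      by_contra! h
      nlinarith [mul_nonneg (mul_nonneg h hb.le) (neg_pos.2 hc).le]
    have e : -a + b = -c := by linarith
    have h := main (neg_pos.2 ha) hb (p₁ := -c⁻¹) (p₂ := -c⁻¹) (p₃ := c⁻¹) (r₁ := -a⁻¹) (r₂ := 0)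
      (r₃ := a⁻¹) (q₁ := 0) (q₂ := b⁻¹) (q₃ := 0) (by rw [e]; field_simp; ring)
      (by rw [e]; field_simp; ring) (by rw [e]; field_simp; ring)
    rw [e] at h
    linarith
  · have h := main hb hc (p₁ := -a⁻¹) (p₂ := 0) (p₃ := a⁻¹) (r₁ := 0) (r₂ := b⁻¹)
      (r₃ := 0) (q₁ := -c⁻¹) (q₂ := -c⁻¹) (q₃ := c⁻¹) (by rw [← habc]; field_simp; ring)
      (by field_simp; ring) (by rw [← habc]; field_simp; ring)
    rw [← habc] at h
    linarith

/-- The matrix with real eigenvalues `d` and eigenvectors the columns of `V`. -/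
noncomputable def conjDiag {n : Type*} [Fintype n] [DecidableEq n] (V : Matrix n n ℂ) (d : n → ℝ) :
    Matrix n n ℂ :=
  V * diagonal (fun i => (d i : ℂ)) * Vᴴ

/-- The squared moduli of the matrix elements of `ψ` between the columns of `W` and of `V`. -/
noncomputable def overlap {m n : Type*} [Fintype m] [Fintype n] (W : Matrix m m ℂ)
    (ψ : Matrix m n ℂ) (V : Matrix n n ℂ) (x : m × n) : ℝ :=
  Complex.normSq ((Wᴴ * ψ * V) x.1 x.2)

theorem overlap_nonneg {m n : Type*} [Fintype m] [Fintype n] (W : Matrix m m ℂ)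
    (ψ : Matrix m n ℂ) (V : Matrix n n ℂ) (x : m × n) : 0 ≤ overlap W ψ V x :=
  Complex.normSq_nonneg _

section ConjDiag

variable {n m : Type*} [Fintype n] [DecidableEq n] [Fintype m] [DecidableEq m]

theorem isHermitian_conjDiag (V : Matrix n n ℂ) (d : n → ℝ) : (conjDiag V d).IsHermitian := by
  simp [IsHermitian, conjDiag, conjTranspose_mul, mul_assoc, diagonal_conjTranspose, Pi.star_def]

theorem posSemidef_conjDiag (V : Matrix n n ℂ) {d : n → ℝ} (hd : ∀ i, 0 ≤ d i) :
    (conjDiag V d).PosSemidef := by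
  refine PosSemidef.mul_mul_conjTranspose_same (PosSemidef.diagonal fun i => ?_) V
  exact Complex.zero_le_real.2 (hd i)

theorem conjDiag_mul {V : Matrix n n ℂ} (hV : Vᴴ * V = 1) (d e : n → ℝ) :
    conjDiag V d * conjDiag V e = conjDiag V (fun i => d i * e i) := by
  unfold conjDiag
  calc _ = V * diagonal (fun i => (d i : ℂ)) * (Vᴴ * V) * diagonal (fun i => (e i : ℂ)) * Vᴴ := by
        simp only [mul_assoc]
    _ = _ := by
        rw [hV, mul_one, mul_assoc V, diagonal_mul_diagonal]
        simp

theorem conjDiag_one {V : Matrix n n ℂ} (hV : V * Vᴴ = 1) : conjDiag V (fun _ => 1) = 1 := by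
  simp [conjDiag, hV]

theorem trace_conjDiag {V : Matrix n n ℂ} (hV : Vᴴ * V = 1) (d : n → ℝ) :
    (conjDiag V d).trace = ((∑ i, d i : ℝ) : ℂ) := by
  rw [conjDiag, trace_mul_comm, ← mul_assoc, hV, one_mul, trace_diagonal]
  simp

theorem conjDiag_kronecker (V : Matrix n n ℂ) (W : Matrix m m ℂ) (d : n → ℝ) (e : m → ℝ) :
    conjDiag V d ⊗ₖ conjDiag W e = conjDiag (V ⊗ₖ W) (fun x => d x.1 * e x.2) := by
  simp only [conjDiag, mul_kronecker_mul, conjTranspose_kronecker,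
    diagonal_kronecker_diagonal, Complex.ofReal_mul]

theorem kronecker_unitary {V : Matrix n n ℂ} {W : Matrix m m ℂ} (hV : Vᴴ * V = 1)
    (hW : Wᴴ * W = 1) : (V ⊗ₖ W)ᴴ * (V ⊗ₖ W) = 1 := by
  rw [conjTranspose_kronecker, ← mul_kronecker_mul, hV, hW, one_kronecker_one]

theorem exists_eq_conjDiag {M : Matrix n n ℂ} (hM : M.PosSemidef) :
    ∃ V : Matrix n n ℂ, ∃ d : n → ℝ, Vᴴ * V = 1 ∧ (∀ i, 0 ≤ d i) ∧ M = conjDiag V d := by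
  refine ⟨hM.1.eigenvectorUnitary, hM.1.eigenvalues, ?_, hM.eigenvalues_nonneg, ?_⟩
  · exact Unitary.coe_star_mul_self hM.1.eigenvectorUnitary
  · conv_lhs => rw [hM.1.spectral_theorem, Unitary.conjStarAlgAut_apply]
    rfl

theorem matPow_conjDiag {V : Matrix n n ℂ} (hV : Vᴴ * V = 1) (d : n → ℝ) (r : ℝ) :
    matPow (conjDiag V d) r = conjDiag V (fun i => supPow (d i) r) := by
  have hM := isHermitian_conjDiag V d
  have hV' : V * Vᴴ = 1 := mul_eq_one_comm.1 hV
  rw [matPow, dif_pos hM]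
  set U : Matrix n n ℂ := (hM.eigenvectorUnitary : Matrix n n ℂ) with hU
  have hUU : Uᴴ * U = 1 := Unitary.coe_star_mul_self hM.eigenvectorUnitary
  have hUU' : U * Uᴴ = 1 := mul_eq_one_comm.1 hUU
  have hspec : U * diagonal (fun i => (hM.eigenvalues i : ℂ)) * Uᴴ = conjDiag V d := by
    conv_rhs => rw [hM.spectral_theorem, Unitary.conjStarAlgAut_apply]
    rfl
  have h1 : diagonal (fun i => (hM.eigenvalues i : ℂ)) * (Uᴴ * V) =
      (Uᴴ * V) * diagonal (fun i => (d i : ℂ)) := by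
    calc _ = Uᴴ * (U * diagonal (fun i => (hM.eigenvalues i : ℂ)) * Uᴴ) * V := by
          simp only [← mul_assoc]; rw [hUU, one_mul]
      _ = _ := by
          rw [hspec, conjDiag]
          simp only [mul_assoc]; rw [hV, mul_one]
  have h2 : diagonal (fun i => (supPow (hM.eigenvalues i) r : ℂ)) * (Uᴴ * V) =
      (Uᴴ * V) * diagonal (fun i => (supPow (d i) r : ℂ)) := by
    ext i j
    have hij := congrFun (congrFun h1 i) j
    rw [diagonal_mul, mul_diagonal] at hij ⊢
    by_cases h0 : (Uᴴ * V) i j = 0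
    · simp [h0]
    · rw [mul_comm] at hij
      have := mul_left_cancel₀ h0 hij
      rw [Complex.ofReal_inj.1 this, mul_comm]
  calc _ = U * (diagonal (fun i => (supPow (hM.eigenvalues i) r : ℂ)) * (Uᴴ * V)) * Vᴴ := by
        rw [← mul_assoc, ← mul_assoc, mul_assoc _ V, hV', mul_one]; rfl
    _ = _ := by
        rw [h2, ← mul_assoc, ← mul_assoc, hUU', one_mul]; rfl

theorem trace_matPow_eq_of_charpoly_eq {M N : Matrix n n ℂ} (hM : M.IsHermitian)
    (hN : N.IsHermitian) (h : M.charpoly = N.charpoly) (r : ℝ) :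
    (matPow M r).trace = (matPow N r).trace := by
  have key : ∀ {K : Matrix n n ℂ} (hK : K.IsHermitian), (matPow K r).trace =
      (K.charpoly.roots.map fun z => (supPow z.re r : ℂ)).sum := by
    intro K hK
    rw [hK.roots_charpoly_eq_eigenvalues, matPow, dif_pos hK, trace_mul_comm, ← mul_assoc,
      Unitary.coe_star_mul_self, one_mul, trace_diagonal]
    simp
  rw [key hM, key hN, h]

theorem trace_diagonal_mul_conjTranspose_mul (Φ : Matrix m n ℂ) (f : m → ℝ) (h : n → ℝ) :
    (diagonal (fun i => (h i : ℂ)) * (Φᴴ * diagonal (fun i => (f i : ℂ)) * Φ)).trace =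
      ((∑ x : m × n, Complex.normSq (Φ x.1 x.2) * (f x.1 * h x.2) : ℝ) : ℂ) := by
  rw [Fintype.sum_prod_type_right]
  simp only [trace, diag_apply, diagonal_mul, Complex.ofReal_sum]
  refine Finset.sum_congr rfl fun k _ => ?_
  rw [mul_apply, Finset.mul_sum]
  refine Finset.sum_congr rfl fun e _ => ?_
  rw [mul_diagonal, conjTranspose_apply]
  simp only [Complex.ofReal_mul, Complex.normSq_eq_conj_mul_self]
  simp only [Complex.star_def]
  ring

theorem trace_conjDiag_mul_conjDiag (W : Matrix m m ℂ) (ψ : Matrix m n ℂ) (V : Matrix n n ℂ)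
    (f : m → ℝ) (h : n → ℝ) :
    (conjDiag V h * (ψᴴ * conjDiag W f * ψ)).trace =
      ((∑ x : m × n, overlap W ψ V x * (f x.1 * h x.2) : ℝ) : ℂ) := by
  unfold overlap
  rw [← trace_diagonal_mul_conjTranspose_mul, conjDiag, conjDiag, mul_assoc V, mul_assoc V,
    trace_mul_comm]
  simp only [conjTranspose_mul, conjTranspose_conjTranspose, Matrix.mul_assoc]

/-- The Hölder inequality for traces, in the direct form for `1 < p` and in the reverse form for
`p < 1`. -/
theorem mul_log_trace_le {X : Matrix n n ℂ} (hX : X.PosSemidef) {V : Matrix n n ℂ}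
    (hV : Vᴴ * V = 1) {κ : n → ℝ} (hκ : ∀ i, 0 ≤ κ i) (hκ1 : ∑ i, κ i = 1) {p : ℝ} (hp : 0 < p)
    (hp1 : p ≠ 1)
    (hsupp : p < 1 → (conjDiag V (fun i => if κ i = 0 then 1 else 0) * X).trace.re = 0)
    (hpos : 0 < (conjDiag V (fun i => supPow (κ i) ((p - 1) / p)) * X).trace.re) :
    p / (p - 1) * Real.log ((conjDiag V (fun i => supPow (κ i) ((p - 1) / p)) * X).trace.re) ≤
      (p - 1)⁻¹ * Real.log ((matPow X p).trace.re) := by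
  obtain ⟨U, x, hU, hx, rfl⟩ := exists_eq_conjDiag hX
  have hU' : U * Uᴴ = 1 := mul_eq_one_comm.1 hU
  have hV' : V * Vᴴ = 1 := mul_eq_one_comm.1 hV
  set q := overlap U 1 V with hq
  have hq0 : ∀ i, 0 ≤ q i := overlap_nonneg U 1 V
  have form : ∀ f h : n → ℝ, (conjDiag V h * conjDiag U f).trace =
      ((∑ i, q i * (f i.1 * h i.2) : ℝ) : ℂ) := fun f h => by
    simpa using trace_conjDiag_mul_conjDiag U (1 : Matrix n n ℂ) V f h
  have hsum : ∑ i, q i * κ i.2 = 1 := by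
    have h := form (fun _ => 1) κ
    rw [conjDiag_one hU', mul_one, trace_conjDiag hV, hκ1] at h
    simpa using (Complex.ofReal_inj.1 h).symm
  have hN : (matPow (conjDiag U x) p).trace.re = ∑ i, q i * supPow (x i.1) p := by
    rw [matPow_conjDiag hU, ← one_mul (conjDiag U _), ← conjDiag_one hV', form, Complex.ofReal_re]
    simp
  rw [hN]
  rw [form, Complex.ofReal_re] at hpos ⊢
  rw [form, Complex.ofReal_re] at hsupp
  rcases lt_or_gt_of_ne hp1 with h1 | h1
  · have hterm : ∀ i, q i * ((x i.1 * supPow (κ i.2) ((p - 1) / p)) ^ p * κ i.2 ^ (1 - p)) =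
        q i * supPow (x i.1) p := fun i => by
      by_cases h0 : κ i.2 = 0
      · have h2 := (Finset.sum_eq_zero_iff_of_nonneg (fun j _ => by
          refine mul_nonneg (hq0 j) (mul_nonneg (hx _) ?_)
          split_ifs <;> norm_num)).1 (hsupp h1) i (Finset.mem_univ _)
        rw [if_pos h0, mul_one] at h2
        rcases mul_eq_zero.1 h2 with h2 | h2
        · simp [h2]
        · simp [h2, h0, supPow_zero_left, Real.zero_rpow hp.ne']
      · have h3 : κ i.2 ^ (1 - p) = supPow (κ i.2) 1 ^ (1 - p) := by rw [supPow_one_right]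
        rw [h3, Real.mul_rpow (hx _) (supPow_nonneg (hκ _) _), mul_assoc,
          supPow_rpow_mul_supPow_rpow (hκ _) hp]
        have : p * ((p - 1) / p) + (1 - p) * 1 = 0 := by field_simp; ring
        rw [this, supPow_zero_right h0, mul_one, supPow_eq_rpow hp.ne']
    have hlhs : ∑ i, q i * ((x i.1 * supPow (κ i.2) ((p - 1) / p)) ^ p * κ i.2 ^ (1 - p)) =
        ∑ i, q i * supPow (x i.1) p := Finset.sum_congr rfl fun i _ => hterm i
    have hNpos : 0 < ∑ i, q i * supPow (x i.1) p := by
      refine (Finset.sum_nonneg fun i _ => mul_nonneg (hq0 i)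
        (supPow_nonneg (hx _) p)).lt_of_ne' fun h0 => hpos.ne' ?_
      refine Finset.sum_eq_zero fun i _ => ?_
      have h2 := (Finset.sum_eq_zero_iff_of_nonneg (fun j _ => mul_nonneg (hq0 j)
        (supPow_nonneg (hx _) p))).1 h0 i (Finset.mem_univ _)
      rcases mul_eq_zero.1 h2 with h2 | h2
      · simp [h2]
      · have : x i.1 = 0 := by
          by_contra h4
          exact (supPow_pos ((hx _).lt_of_ne' h4) p).ne' h2
        simp [this]
    have h := log_sum_mul_rpow_mul_rpow_le (ι := n × n) (w := q)
      (u := fun i => x i.1 * supPow (κ i.2) ((p - 1) / p)) (v := fun i => κ i.2)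
      hq0 (fun i => mul_nonneg (hx _) (supPow_nonneg (hκ _) _)) (fun i => hκ _) hp
      (sub_pos.2 h1) (by ring) (hlhs ▸ hNpos)
    rw [hlhs, hsum, Real.log_one, mul_zero, add_zero] at h
    rw [div_eq_mul_inv, mul_comm p, mul_assoc]
    exact mul_le_mul_of_nonpos_left h (inv_nonpos.2 (by linarith))
  · have hc : 0 < (p - 1) / p := div_pos (by linarith) hp
    have hterm : ∀ i : n × n, x i.1 * supPow (κ i.2) ((p - 1) / p) =
        supPow (x i.1) p ^ (1 / p) * κ i.2 ^ ((p - 1) / p) := fun i => by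
      rw [supPow_eq_rpow hc.ne', supPow_eq_rpow hp.ne', ← Real.rpow_mul (hx _),
        mul_one_div_cancel hp.ne', Real.rpow_one]
    simp only [hterm] at hpos ⊢
    have h := log_sum_mul_rpow_mul_rpow_le (ι := n × n) (w := q)
      (u := fun i => supPow (x i.1) p) (v := fun i => κ i.2)
      hq0 (fun i => supPow_nonneg (hx _) _) (fun i => hκ _) (one_div_pos.2 hp)
      hc (by field_simp; ring) hpos
    rw [hsum, Real.log_one, mul_zero, add_zero] at h
    have hp' : 0 < p - 1 := by linarith
    calc _ ≤ p / (p - 1) * (1 / p * Real.log (∑ i, q i * supPow (x i.1) p)) := by gcongr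
      _ = _ := by field_simp

end ConjDiag

theorem Dominates.mul_eq_zero {n : Type*} [Fintype n] {σ ρ : Matrix n n ℂ} (h : Dominates σ ρ) {M : Matrix n n ℂ}
    (hM : σ * M = 0) : ρ * M = 0 := by
  ext i j
  have hv : σ.mulVec (fun k => M k j) = 0 := by
    ext i; exact congrFun (congrFun hM i) j
  exact congrFun (h _ hv) i

section Dominates

variable {n : Type*} [Fintype n] [DecidableEq n]

theorem overlap_eq_zero_of_dominates {W ψ V : Matrix n n ℂ} (hW : Wᴴ * W = 1) (hV : V * Vᴴ = 1)
    (hψ : ψ.IsHermitian) {d : n → ℝ} (h : Dominates (conjDiag W d) (ψ * ψ)) (x : n × n)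
    (hx : d x.1 = 0) : overlap W ψ V x = 0 := by
  have h1 := h.mul_eq_zero (M := conjDiag W fun i => if d i = 0 then 1 else 0) (by
    rw [conjDiag_mul hW]
    have : (fun i => d i * if d i = 0 then 1 else 0) = fun _ => (0 : ℝ) := by
      ext i; split_ifs with h0 <;> simp [h0]
    simp only [this]
    simp [conjDiag])
  have h2 := trace_conjDiag_mul_conjDiag W ψ V (fun i => if d i = 0 then 1 else 0) (fun _ => 1)
  rw [conjDiag_one hV, one_mul, hψ.eq, trace_mul_comm, ← mul_assoc, h1, trace_zero, eq_comm,
    Complex.ofReal_eq_zero, Finset.sum_eq_zero_iff_of_nonneg] at h2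
  · simpa [hx] using h2 x (Finset.mem_univ _)
  · intro y _
    refine mul_nonneg (overlap_nonneg _ _ _ _) (mul_nonneg ?_ zero_le_one)
    split_ifs <;> norm_num

theorem posSemidef_sandwich {ψ : Matrix n n ℂ} (hψ : ψ.IsHermitian) (W : Matrix n n ℂ)
    {d : n → ℝ} (hd : ∀ i, 0 ≤ d i) : (ψ * conjDiag W d * ψ).PosSemidef := by
  have h := (posSemidef_conjDiag W hd).conjTranspose_mul_mul_same ψ
  rwa [hψ.eq] at h

theorem trace_matPow_sandwich {ψ W : Matrix n n ℂ} (hψ : ψ.IsHermitian) (hW : Wᴴ * W = 1)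
    {d : n → ℝ} (hd : ∀ i, 0 ≤ d i) (α : ℝ) :
    (matPow (matPow (conjDiag W d) ((1 - α) / (2 * α)) * (ψ * ψ) *
      matPow (conjDiag W d) ((1 - α) / (2 * α))) α).trace =
    (matPow (ψ * conjDiag W (fun i => supPow (d i) (-((α - 1) / α))) * ψ) α).trace := by
  rw [matPow_conjDiag hW]
  set S := conjDiag W fun i => supPow (d i) ((1 - α) / (2 * α)) with hS
  have hSH : S.IsHermitian := isHermitian_conjDiag _ _
  have hSS : conjDiag W (fun i => supPow (d i) (-((α - 1) / α))) = S * S := by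
    rw [hS, conjDiag_mul hW]
    congr 1; ext i
    rw [supPow_add (hd i)]
    congr 1
    by_cases h : α = 0
    · simp [h]
    · field_simp; ring
  have h1 : S * (ψ * ψ) * S = (S * ψ) * (ψ * S) := by simp only [mul_assoc]
  have h2 : ψ * (S * S) * ψ = (ψ * S) * (S * ψ) := by simp only [mul_assoc]
  rw [hSS, h1, h2]
  refine trace_matPow_eq_of_charpoly_eq ?_ ?_ (charpoly_mul_comm _ _) α
  · have h := isHermitian_mul_conjTranspose_self (S * ψ)
    rwa [conjTranspose_mul, hSH.eq, hψ.eq] at h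
  · have h := isHermitian_mul_conjTranspose_self (ψ * S)
    rwa [conjTranspose_mul, hSH.eq, hψ.eq] at h

end Dominates

theorem posSemidef_margSnd {A B : Type*} [Fintype A] {ρ : Matrix (A × B) (A × B) ℂ} (hρ : ρ.PosSemidef) :
    (margSnd ρ).PosSemidef := by
  have h : margSnd ρ = ∑ a, ρ.submatrix (fun b : B => (a, b)) (fun b : B => (a, b)) := by
    ext b b'; simp [margSnd, Matrix.sum_apply]
  rw [h]
  exact posSemidef_sum _ fun a _ => hρ.submatrix _

theorem trace_mul_margSnd {A B : Type*} [Fintype A] [Fintype B] [DecidableEq A]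
    (S : Matrix B B ℂ) (ρ : Matrix (A × B) (A × B) ℂ) :
    (S * margSnd ρ).trace = (((1 : Matrix A A ℂ) ⊗ₖ S) * ρ).trace := by
  simp only [trace, diag_apply, mul_apply, margSnd, of_apply, Fintype.sum_prod_type,
    kroneckerMap_apply, one_apply, ite_mul, one_mul, zero_mul, Finset.mul_sum]
  simp only [Finset.sum_ite_irrel, Finset.sum_const_zero, Finset.sum_ite_eq, Finset.mem_univ,
    if_true]
  rw [Finset.sum_comm (s := (Finset.univ : Finset A))]
  exact Finset.sum_congr rfl fun b _ => Finset.sum_comm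

section Decomposition

variable {A B : Type*} [Fintype A] [Fintype B] [DecidableEq A] [DecidableEq B]

/-- The decomposition inequality for states given in diagonal form, with `ψ` a square root of the
bipartite state. -/
theorem log_trace_decomposition {ψ : Matrix (A × B) (A × B) ℂ} (hψ : ψ.IsHermitian)
    {U : Matrix A A ℂ} {V : Matrix B B ℂ} (hU : Uᴴ * U = 1) (hV : Vᴴ * V = 1)
    {s : A → ℝ} {t : B → ℝ} (hs : ∀ i, 0 ≤ s i) (ht : ∀ i, 0 ≤ t i) (ht1 : ∑ i, t i = 1)
    {α β γ : ℝ} (hα : 0 < α) (hβ : 0 < β) (hγ : 0 < γ)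
    (hα1 : α ≠ 1) (hβ1 : β ≠ 1) (hγ1 : γ ≠ 1)
    (hrel : α / (α - 1) = β / (β - 1) + γ / (γ - 1))
    (hsign : 0 < (α - 1) * (β - 1) * (γ - 1))
    (htr : (ψ * ψ * (conjDiag (U ⊗ₖ V) fun e => s e.1 * t e.2)).trace ≠ 0)
    (hdom : 1 < γ → Dominates (conjDiag (U ⊗ₖ V) fun e => s e.1 * t e.2) (ψ * ψ)) :
    (α - 1)⁻¹ * Real.log ((matPow (ψ * (conjDiag (U ⊗ₖ V) fun e =>
        supPow (s e.1) (-((α - 1) / α))) * ψ) α).trace.re) ≤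
      (β - 1)⁻¹ * Real.log ((matPow (margSnd (ψ * ψ)) β).trace.re) +
      (γ - 1)⁻¹ * Real.log ((matPow (ψ * (conjDiag (U ⊗ₖ V) fun e =>
        supPow (s e.1 * t e.2) (-((γ - 1) / γ))) * ψ) γ).trace.re) := by
  have hW : (U ⊗ₖ V)ᴴ * (U ⊗ₖ V) = 1 := kronecker_unitary hU hV
  set W := U ⊗ₖ V with hWdef
  have hα0 : α - 1 ≠ 0 := sub_ne_zero.2 hα1
  have hβ0 : β - 1 ≠ 0 := sub_ne_zero.2 hβ1
  have hγ0 : γ - 1 ≠ 0 := sub_ne_zero.2 hγ1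
  set a := α / (α - 1) with ha
  set b := β / (β - 1) with hb
  set c := γ / (γ - 1) with hc
  have ha' : (α - 1) / α = a⁻¹ := by rw [ha, inv_div]
  have hb' : (β - 1) / β = b⁻¹ := by rw [hb, inv_div]
  have hc' : (γ - 1) / γ = c⁻¹ := by rw [hc, inv_div]
  rw [ha', hc']
  have hS : ∀ i, 0 ≤ supPow (s i) (-a⁻¹) := fun i => supPow_nonneg (hs i) _
  have hXpsd := posSemidef_sandwich hψ W (d := fun e => supPow (s e.1) (-a⁻¹)) fun e => hS e.1
  obtain ⟨K, x, hK, hx, hX⟩ := exists_eq_conjDiag hXpsd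
  have hK' : K * Kᴴ = 1 := mul_eq_one_comm.1 hK
  set p := overlap W ψ K with hp
  have hp0 : ∀ i, 0 ≤ p i := overlap_nonneg W ψ K
  have form : ∀ (f h : A × B → ℝ), (conjDiag K h * (ψ * conjDiag W f * ψ)).trace =
      ((∑ i, p i * (f i.1 * h i.2) : ℝ) : ℂ) := fun f h => by
    simpa only [hψ.eq] using trace_conjDiag_mul_conjDiag W ψ K f h
  have form1 : ∀ f : A × B → ℝ, (conjDiag W f * (ψ * ψ)).trace =
      ((∑ i, p i * f i.1 : ℝ) : ℂ) := fun f => by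
    have h := form f fun _ => 1
    simp only [mul_one, conjDiag_one hK', one_mul] at h
    rw [← h, mul_assoc ψ, trace_mul_comm ψ, mul_assoc]
  have hxsum : ∀ k, x k = ∑ e, p (e, k) * supPow (s e.1) (-a⁻¹) := fun k => by
    have h := form (fun e => supPow (s e.1) (-a⁻¹)) (Pi.single k 1)
    rw [hX, conjDiag_mul hK, trace_conjDiag hK, Complex.ofReal_inj] at h
    have h1 : ∑ i, (Pi.single k 1 : A × B → ℝ) i * x i = x k := by simp [Pi.single_apply]
    rw [← h1, h, Fintype.sum_prod_type]
    simp [Pi.single_apply]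
  have hxpos : ∀ i : (A × B) × (A × B), p i ≠ 0 → s i.1.1 ≠ 0 → 0 < x i.2 := fun i hpi hsi => by
    rw [hxsum]
    refine Finset.sum_pos' (fun e _ => mul_nonneg (hp0 _) (hS _)) ⟨i.1, Finset.mem_univ _, ?_⟩
    exact mul_pos ((hp0 i).lt_of_ne' hpi) (supPow_pos ((hs _).lt_of_ne' hsi) _)
  obtain ⟨i₀, hi₀⟩ : ∃ i, p i * (s i.1.1 * t i.1.2) ≠ 0 := by
    by_contra! h
    rw [trace_mul_comm, form1] at htr
    exact htr (by rw [Finset.sum_eq_zero fun i _ => h i, Complex.ofReal_zero])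
  have hi₀p : p i₀ ≠ 0 := left_ne_zero_of_mul hi₀
  have hi₀s : s i₀.1.1 ≠ 0 := left_ne_zero_of_mul (right_ne_zero_of_mul hi₀)
  have hi₀t : t i₀.1.2 ≠ 0 := right_ne_zero_of_mul (right_ne_zero_of_mul hi₀)
  set N := ∑ k, supPow (x k) α with hN
  have hNpos : 0 < N := Finset.sum_pos' (fun k _ => supPow_nonneg (hx k) _)
    ⟨i₀.2, Finset.mem_univ _, supPow_pos (hxpos i₀ hi₀p hi₀s) _⟩
  set κ : A × B → ℝ := fun k => supPow (x k) α / N with hκdef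
  have hκ : ∀ k, 0 ≤ κ k := fun k => div_nonneg (supPow_nonneg (hx k) _) hNpos.le
  have hκ1 : ∑ k, κ k = 1 := by rw [← Finset.sum_div, div_self hNpos.ne']
  have hκpos : ∀ i : (A × B) × (A × B), p i ≠ 0 → s i.1.1 ≠ 0 → 0 < κ i.2 := fun i hpi hsi =>
    div_pos (supPow_pos (hxpos i hpi hsi) _) hNpos
  have hdom' : 1 < γ → ∀ i, p i ≠ 0 → s i.1.1 ≠ 0 ∧ t i.1.2 ≠ 0 ∧ κ i.2 ≠ 0 := fun hγ' i hpi => by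
    have h : s i.1.1 * t i.1.2 ≠ 0 := fun h =>
      hpi (overlap_eq_zero_of_dominates hW hK' hψ (hdom hγ') i h)
    exact ⟨left_ne_zero_of_mul h, right_ne_zero_of_mul h,
      (hκpos i hpi (left_ne_zero_of_mul h)).ne'⟩
  have habc : 0 < a * b * c := by
    have : a * b * c = α * β * γ / ((α - 1) * (β - 1) * (γ - 1)) := by
      rw [ha, hb, hc]; field_simp
    rw [this]; positivity
  set F := powSum p (fun i => s i.1.1) (fun i => t i.1.2) (fun i => κ i.2) with hF
  have hFpos : ∀ r₁ r₂ r₃, 0 < F r₁ r₂ r₃ := powSum_pos hp0 (fun i => hs _) (fun i => ht _)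
    (fun i => hκ _) ((hp0 i₀).lt_of_ne' hi₀p) ((hs _).lt_of_ne' hi₀s) ((ht _).lt_of_ne' hi₀t)
    (hκpos i₀ hi₀p hi₀s)
  have key := log_powSum_decomposition hp0 (fun i => hs i.1.1) (fun i => ht i.1.2)
    (fun i => hκ i.2) ((hp0 i₀).lt_of_ne' hi₀p) ((hs _).lt_of_ne' hi₀s) ((ht _).lt_of_ne' hi₀t)
    (hκpos i₀ hi₀p hi₀s) hrel habc
  have hsign' : γ < 1 → a < 0 ∧ 0 < b := fun h => by
    have hc0 : c < 0 := div_neg_of_pos_of_neg hγ (by linarith)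
    have hab : a * b < 0 := by nlinarith
    rcases lt_or_ge 0 b with h' | h'
    · exact ⟨by nlinarith, h'⟩
    · have : a ≤ 0 := by linarith
      nlinarith [mul_nonneg (neg_nonneg.2 this) (neg_nonneg.2 h')]
  have hproj : ∀ {x : ℝ}, 0 ≤ x → supPow x 0 ≤ 1 := fun {x} _ => by
    unfold supPow; split_ifs <;> simp
  have hA : a * Real.log (∑ i, p i * (supPow (s i.1.1) (-a⁻¹) * supPow (κ i.2) a⁻¹)) ≤
      a * Real.log (F (-a⁻¹) 0 a⁻¹) := by
    rcases lt_or_gt_of_ne hγ1 with h | h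
    · refine mul_le_mul_of_nonpos_left (Real.log_le_log (hFpos _ _ _) ?_) (hsign' h).1.le
      refine Finset.sum_le_sum fun i _ => mul_le_mul_of_nonneg_left ?_ (hp0 i)
      refine mul_le_mul_of_nonneg_right ?_ (supPow_nonneg (hκ _) _)
      exact mul_le_of_le_one_right (hS _) (hproj (ht _))
    · refine le_of_eq (congrArg (fun y => a * Real.log y) (Finset.sum_congr rfl fun i _ => ?_))
      by_cases hpi : p i = 0
      · simp [hpi]
      · simp [supPow_zero_right (hdom' h i hpi).2.1]
  have hB : b * Real.log (F 0 b⁻¹ 0) ≤ b * Real.log (∑ i, p i * supPow (t i.1.2) b⁻¹) ∧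
      0 < ∑ i, p i * supPow (t i.1.2) b⁻¹ := by
    have hle : F 0 b⁻¹ 0 ≤ ∑ i, p i * supPow (t i.1.2) b⁻¹ := by
      refine Finset.sum_le_sum fun i _ => mul_le_mul_of_nonneg_left ?_ (hp0 i)
      have ht' := supPow_nonneg (ht i.1.2) b⁻¹
      exact (mul_le_of_le_one_right (mul_nonneg (supPow_nonneg (hs _) _) ht') (hproj (hκ _))).trans
        (mul_le_of_le_one_left ht' (hproj (hs _)))
    refine ⟨?_, (hFpos _ _ _).trans_le hle⟩
    rcases lt_or_gt_of_ne hγ1 with h | h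
    · exact mul_le_mul_of_nonneg_left (Real.log_le_log (hFpos _ _ _) hle) (hsign' h).2.le
    · refine le_of_eq (congrArg (fun y => b * Real.log y) (Finset.sum_congr rfl fun i _ => ?_))
      by_cases hpi : p i = 0
      · simp [hpi]
      · simp [supPow_zero_right (hdom' h i hpi).1, supPow_zero_right (hdom' h i hpi).2.2]
  have hattain : ∑ i, p i * (supPow (s i.1.1) (-a⁻¹) * supPow (κ i.2) a⁻¹) = N ^ α⁻¹ := by
    have h := form (fun e => supPow (s e.1) (-a⁻¹)) (fun k => supPow (κ k) a⁻¹)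
    rw [hX, conjDiag_mul hK, trace_conjDiag hK, Complex.ofReal_inj] at h
    rw [← h]
    have hpt : ∀ k, supPow (κ k) a⁻¹ * x k = supPow (x k) α * (N ^ a⁻¹)⁻¹ := fun k => by
      by_cases h0 : x k = 0
      · simp [h0, supPow_zero_left]
      · have hxk := (hx k).lt_of_ne' h0
        have hκk : κ k ≠ 0 := (div_pos (supPow_pos hxk _) hNpos).ne'
        rw [supPow, if_neg hκk, hκdef]
        simp only [supPow, if_neg h0]
        rw [Real.div_rpow (by positivity) hNpos.le, ← Real.rpow_mul hxk.le, div_mul_eq_mul_div,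
          ← Real.rpow_add_one h0, div_eq_mul_inv, ← ha']
        congr 2
        field_simp; ring
    rw [Finset.sum_congr rfl fun k _ => hpt k, ← Finset.sum_mul, ← hN, ← Real.rpow_neg hNpos.le]
    conv_lhs => rw [← Real.rpow_one N, ← Real.rpow_mul hNpos.le, ← Real.rpow_add hNpos]
    congr 1
    rw [← ha']; field_simp; ring
  have hAeq : a * Real.log (∑ i, p i * (supPow (s i.1.1) (-a⁻¹) * supPow (κ i.2) a⁻¹)) =
      (α - 1)⁻¹ * Real.log ((matPow (ψ * (conjDiag W fun e =>
        supPow (s e.1) (-a⁻¹)) * ψ) α).trace.re) := by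
    rw [hattain, hX, matPow_conjDiag hK, trace_conjDiag hK, Complex.ofReal_re, ← hN,
      Real.log_rpow hNpos, ha]
    field_simp
  have hρ : (ψ * ψ).PosSemidef := by
    have h := posSemidef_conjTranspose_mul_self ψ
    rwa [hψ.eq] at h
  have hmarg : ∀ g : B → ℝ, (conjDiag V g * margSnd (ψ * ψ)).trace.re =
      ∑ i, p i * g i.1.2 := fun g => by
    rw [trace_mul_margSnd, ← conjDiag_one (mul_eq_one_comm.1 hU), conjDiag_kronecker, ← hWdef,
      form1, Complex.ofReal_re]
    simp
  have hBH := mul_log_trace_le (posSemidef_margSnd hρ) hV ht ht1 hβ hβ1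
    (fun h => by
      have hγ' : 1 < γ := by
        by_contra! h'
        have := (hsign' (h'.lt_of_ne hγ1)).2
        have h2 : b < 0 := div_neg_of_pos_of_neg hβ (by linarith)
        linarith
      rw [hmarg]
      refine Finset.sum_eq_zero fun i _ => ?_
      by_cases hpi : p i = 0
      · simp [hpi]
      · simp [(hdom' hγ' i hpi).2.1])
    (by rw [hmarg, hb']; exact hB.2)
  rw [hmarg, hb', ← hb] at hBH
  have hCF : (conjDiag K (fun k => supPow (κ k) c⁻¹) * (ψ * (conjDiag W fun e =>
      supPow (s e.1 * t e.2) (-c⁻¹)) * ψ)).trace.re = F (-c⁻¹) (-c⁻¹) c⁻¹ := by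
    rw [form, Complex.ofReal_re]
    exact Finset.sum_congr rfl fun i _ => by rw [supPow_mul (hs _) (ht _)]
  have hCH := mul_log_trace_le (posSemidef_sandwich hψ W (d := fun e =>
      supPow (s e.1 * t e.2) (-c⁻¹)) fun e => supPow_nonneg (mul_nonneg (hs _) (ht _)) _)
    hK hκ hκ1 hγ hγ1
    (fun _ => by
      rw [form, Complex.ofReal_re]
      refine Finset.sum_eq_zero fun i _ => ?_
      by_cases hpi : p i = 0
      · simp [hpi]
      by_cases hsi : s i.1.1 = 0
      · simp [hsi, supPow_zero_left]
      · simp [(hκpos i hpi hsi).ne'])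
    (by rw [hc', hCF]; exact hFpos _ _ _)
  rw [hc', hCF, ← hc] at hCH
  linarith [hB.1]

theorem exists_sqrt {n : Type*} [Fintype n] [DecidableEq n] {ρ : Matrix n n ℂ}
    (hρ : ρ.PosSemidef) : ∃ ψ : Matrix n n ℂ, ψ.IsHermitian ∧ ρ = ψ * ψ := by
  obtain ⟨R, r, hR, hr, rfl⟩ := exists_eq_conjDiag hρ
  refine ⟨conjDiag R fun i => √(r i), isHermitian_conjDiag _ _, ?_⟩
  rw [conjDiag_mul hR]
  simp only [Real.mul_self_sqrt (hr _)]

theorem trace_mul_kronecker_one_ne_zero {ρ : Matrix (A × B) (A × B) ℂ} (hρ : ρ.PosSemidef)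
    {σA : Matrix A A ℂ} {σB : Matrix B B ℂ} (hA : σA.PosSemidef) (hB : σB.PosSemidef)
    (h : (ρ * (σA ⊗ₖ σB)).trace ≠ 0) : (ρ * (σA ⊗ₖ (1 : Matrix B B ℂ))).trace ≠ 0 := by
  obtain ⟨ψ, hψ, rfl⟩ := exists_sqrt hρ
  obtain ⟨U, s, hU, hs, rfl⟩ := exists_eq_conjDiag hA
  obtain ⟨V, t, hV, ht, rfl⟩ := exists_eq_conjDiag hB
  have form : ∀ f : A × B → ℝ, (ψ * ψ * conjDiag (U ⊗ₖ V) f).trace =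
      ((∑ i, overlap (U ⊗ₖ V) ψ 1 i * f i.1 : ℝ) : ℂ) := fun f => by
    have h := trace_conjDiag_mul_conjDiag (U ⊗ₖ V) ψ 1 f fun _ => 1
    rw [conjDiag_one (by simp), one_mul, hψ.eq] at h
    simp only [mul_one] at h
    rw [← h, mul_assoc, trace_mul_comm ψ]
  rw [conjDiag_kronecker, form] at h
  rw [← conjDiag_one (mul_eq_one_comm.1 hV), conjDiag_kronecker, form]
  refine fun h0 => h ?_
  rw [Complex.ofReal_eq_zero, Finset.sum_eq_zero_iff_of_nonneg (fun i _ => mul_nonneg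
    (overlap_nonneg _ _ _ _) (mul_nonneg (hs _) zero_le_one))] at h0
  rw [Complex.ofReal_eq_zero]
  refine Finset.sum_eq_zero fun i hi => ?_
  have h1 := h0 i hi
  rw [mul_one] at h1
  rw [← mul_assoc, h1, zero_mul]

theorem renyiDiv_of_finite {n : Type*} [Fintype n] [DecidableEq n] {α : ℝ} {ρ σ : Matrix n n ℂ}
    (h : (ρ * σ).trace ≠ 0 ∧ (Dominates σ ρ ∨ α < 1)) :
    renyiDiv α ρ σ = (((α - 1)⁻¹ * Real.logb 2 ((matPow (matPow σ ((1 - α) / (2 * α)) * ρ *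
      matPow σ ((1 - α) / (2 * α))) α).trace.re) : ℝ) : EReal) := if_pos h

theorem renyiDiv_lower_bound {ρ : Matrix (A × B) (A × B) ℂ} (hρ : ρ.PosSemidef)
    {σA : Matrix A A ℂ} {σB : Matrix B B ℂ} (hA : σA.PosSemidef) (hB : IsDensity σB)
    {α β γ : ℝ} (hα : 0 < α) (hβ : 0 < β) (hγ : 0 < γ)
    (hα1 : α ≠ 1) (hβ1 : β ≠ 1) (hγ1 : γ ≠ 1)
    (hrel : α / (α - 1) = β / (β - 1) + γ / (γ - 1))
    (hsign : 0 < (α - 1) * (β - 1) * (γ - 1)) :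
    (renyiEntropy β (margSnd ρ) : EReal) + renyiDiv α ρ (σA ⊗ₖ (1 : Matrix B B ℂ)) ≤
      renyiDiv γ ρ (σA ⊗ₖ σB) := by
  by_cases hfin : (ρ * (σA ⊗ₖ σB)).trace ≠ 0 ∧ (Dominates (σA ⊗ₖ σB) ρ ∨ γ < 1)
  swap
  · rw [show renyiDiv γ ρ (σA ⊗ₖ σB) = ⊤ from if_neg hfin]
    exact le_top
  have hfin' : (ρ * (σA ⊗ₖ (1 : Matrix B B ℂ))).trace ≠ 0 ∧
      (Dominates (σA ⊗ₖ (1 : Matrix B B ℂ)) ρ ∨ α < 1) := by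
    refine ⟨trace_mul_kronecker_one_ne_zero hρ hA hB.1 hfin.1, hfin.2.imp (fun h v hv => h v ?_)
      fun h => ?_⟩
    · by_contra! h'
      have hα0 : 0 < α - 1 := sub_pos.2 (h'.lt_of_ne' hα1)
      have hγ0 : γ - 1 < 0 := by linarith
      have ha : 0 < α / (α - 1) := div_pos hα hα0
      have hc : γ / (γ - 1) < 0 := div_neg_of_pos_of_neg hγ hγ0
      rcases lt_or_ge 0 (β - 1) with hβ0 | hβ0
      · nlinarith [mul_pos hα0 hβ0]
      · linarith [div_nonpos_of_nonneg_of_nonpos hβ.le hβ0]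
    · have hfac : σA ⊗ₖ σB = ((1 : Matrix A A ℂ) ⊗ₖ σB) * (σA ⊗ₖ (1 : Matrix B B ℂ)) := by
        rw [← mul_kronecker_mul, one_mul, mul_one]
      rw [hfac, ← mulVec_mulVec, hv, mulVec_zero]
  rw [renyiDiv_of_finite hfin, renyiDiv_of_finite hfin', renyiEntropy, ← EReal.coe_add,
    EReal.coe_le_coe_iff]
  obtain ⟨ψ, hψ, rfl⟩ := exists_sqrt hρ
  obtain ⟨U, s, hU, hs, rfl⟩ := exists_eq_conjDiag hA
  obtain ⟨V, t, hV, ht, rfl⟩ := exists_eq_conjDiag hB.1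
  have ht1 : ∑ i, t i = 1 := by
    have h := hB.2
    rw [trace_conjDiag hV] at h
    exact_mod_cast h
  have hW := kronecker_unitary hU hV
  rw [← conjDiag_one (mul_eq_one_comm.1 hV)]
  rw [conjDiag_kronecker] at hfin ⊢
  rw [conjDiag_kronecker]
  simp only [mul_one]
  rw [trace_matPow_sandwich hψ hW (fun e => hs e.1),
    trace_matPow_sandwich hψ hW (fun e => mul_nonneg (hs e.1) (ht e.2))]
  have h := log_trace_decomposition hψ hU hV hs ht ht1 hα hβ hγ hα1 hβ1 hγ1 hrel hsign hfin.1
    (fun h => hfin.2.resolve_right h.not_gt)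
  rw [← neg_sub β 1, inv_neg]
  simp only [Real.logb, ← mul_div_assoc]
  rw [← add_div]
  refine div_le_div_of_nonneg_right ?_ (Real.log_nonneg (by norm_num))
  linarith

end Decomposition

/-- **Decomposition rule (Theorem 1, Eq. (9)):** for `α > 0`, `β, γ ≥ 1/2` with
`α/(α−1) = β/(β−1) + γ/(γ−1)` and `(α−1)(β−1)(γ−1) > 0`, we have
`I↓_γ(A:B)_ρ ≥ H_β(B)_ρ − H↑_α(B|A)_ρ`. -/
theorem renyi_decomposition_down_ge
    {A B : Type*} [Fintype A] [Fintype B] [DecidableEq A] [DecidableEq B]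
    (ρ : Matrix (A × B) (A × B) ℂ) (hρ : IsDensity ρ)
    {α β γ : ℝ} (hα : 0 < α) (hβ : 1 / 2 ≤ β) (hγ : 1 / 2 ≤ γ)
    (hα1 : α ≠ 1) (hβ1 : β ≠ 1) (hγ1 : γ ≠ 1)
    (hrel : α / (α - 1) = β / (β - 1) + γ / (γ - 1))
    (hsign : 0 < (α - 1) * (β - 1) * (γ - 1)) :
    mutInfDown γ ρ ≥ (renyiEntropy β (margSnd ρ) : EReal) - condEntUp α ρ := by
  refine le_iInf fun σA => le_iInf fun σB => ?_
  refine le_trans ?_ (renyiDiv_lower_bound hρ.1 σA.2.1 σB.2 hα (by linarith) (by linarith)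
    hα1 hβ1 hγ1 hrel hsign)
  rw [sub_eq_add_neg]
  refine add_le_add le_rfl (EReal.neg_le.1 ?_)
  exact le_iSup (fun σA : {σ : Matrix A A ℂ // IsDensity σ} =>
    - renyiDiv α ρ ((σA : Matrix A A ℂ) ⊗ₖ (1 : Matrix B B ℂ))) σA
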